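/- Let (Ω, 𝒜, P) be a probability space and let Y : Ω × [0,1] → ℝ be jointly measurable such that for every ω the sample path θ ↦ Y(ω, θ) is continuously differentiable on [0,1], with partial derivative Y'(ω, θ) jointly measurable and with E[∫_0^1 Y'(ω, θ)² dθ] < ∞. Let m be a positive integer, δ = 1/m, and let Y_δ(ω, ·) denote the piecewise-linear interpolant of Y(ω, ·) at the knots j/m, j = 0, …, m (so Y_δ(ω, θ) = Y(ω, j/m) + m(θ − j/m)(Y(ω, (j+1)/m) − Y(ω, j/m)) for θ ∈ [j/m, (j+1)/m]). Then for every ε > 0, P( sup_{θ ∈ [0,1]} |Y_δ(ω, θ) − Y(ω, θ)| ≥ ε ) ≤ (δ/ε²) · E[∫_0^1 Y'(ω, θ)² dθ]. -/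

import Mathlib

open MeasureTheory Set

/-- The Cauchy–Schwarz inequality against the constant function on an interval. -/
theorem sq_intervalIntegral_le {f : ℝ → ℝ} {a b : ℝ} (hab : a ≤ b)
    (hf : ContinuousOn f (Icc a b)) :
    (∫ t in a..b, f t) ^ 2 ≤ (b - a) * ∫ t in a..b, f t ^ 2 := by
  rcases hab.eq_or_lt with rfl | hlt
  · simp
  have hf₁ : IntervalIntegrable f volume a b := hf.intervalIntegrable_of_Icc hab
  have hf₂ : IntervalIntegrable (fun t => f t ^ 2) volume a b :=
    (hf.pow 2).intervalIntegrable_of_Icc hab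
  have hpos : 0 < b - a := sub_pos.2 hlt
  set d := ∫ t in a..b, f t
  set c := d / (b - a)
  have hcd : c * (b - a) = d := div_mul_cancel₀ _ hpos.ne'
  have hnonneg : 0 ≤ ∫ t in a..b, (f t - c) ^ 2 :=
    intervalIntegral.integral_nonneg hab fun t _ => sq_nonneg _
  have hexpand : ∫ t in a..b, (f t - c) ^ 2
      = (∫ t in a..b, f t ^ 2) - 2 * c * d + (b - a) * c ^ 2 := by
    have : ∀ t, (f t - c) ^ 2 = f t ^ 2 - 2 * c * f t + c ^ 2 := fun t => by ring
    simp_rw [this]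
    rw [intervalIntegral.integral_add (hf₂.sub (hf₁.const_mul _)) intervalIntegrable_const,
      intervalIntegral.integral_sub hf₂ (hf₁.const_mul _),
      intervalIntegral.integral_const_mul, intervalIntegral.integral_const, smul_eq_mul]
  rw [hexpand] at hnonneg
  have := mul_nonneg hpos.le hnonneg
  rw [← hcd] at this ⊢
  nlinarith

/-- The increment of a continuously differentiable function is controlled by the `L²` norm of its
derivative. -/
theorem sq_sub_le_mul_integral_sq_deriv {f f' : ℝ → ℝ} {a b : ℝ} (hab : a ≤ b)
    (hderiv : ∀ t ∈ Icc a b, HasDerivWithinAt f (f' t) (Icc a b) t)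
    (hcont : ContinuousOn f' (Icc a b)) :
    (f b - f a) ^ 2 ≤ (b - a) * ∫ t in a..b, f' t ^ 2 := by
  rw [← intervalIntegral.integral_eq_sub_of_hasDerivAt_of_le hab
    (fun t ht => (hderiv t ht).continuousWithinAt)
    (fun t ht => (hderiv t (Ioo_subset_Icc_self ht)).hasDerivAt (Icc_mem_nhds ht.1 ht.2))
    (hcont.intervalIntegrable_of_Icc hab)]
  exact sq_intervalIntegral_le hab hcont

/-- The error of affine interpolation on `[a, b]` is controlled by the `L²` norm of the
derivative. -/
theorem sq_affine_interpolation_error_le {f f' : ℝ → ℝ} {a b s : ℝ} (hab : a ≤ b)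
    (hderiv : ∀ t ∈ Icc a b, HasDerivWithinAt f (f' t) (Icc a b) t)
    (hcont : ContinuousOn f' (Icc a b)) (hs : s ∈ Icc (0 : ℝ) 1) :
    (f a + s * (f b - f a) - f (a + s * (b - a))) ^ 2 ≤ (b - a) * ∫ t in a..b, f' t ^ 2 := by
  obtain ⟨hs₀, hs₁⟩ := hs
  have hlen : 0 ≤ b - a := sub_nonneg.2 hab
  set x := a + s * (b - a) with hx
  have hax : a ≤ x := by nlinarith
  have hxb : x ≤ b := by nlinarith
  have hleft : Icc a x ⊆ Icc a b := Icc_subset_Icc_right hxb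
  have hright : Icc x b ⊆ Icc a b := Icc_subset_Icc_left hax
  have h₁ := sq_sub_le_mul_integral_sq_deriv hax
    (fun t ht => (hderiv t (hleft ht)).mono hleft) (hcont.mono hleft)
  have h₂ := sq_sub_le_mul_integral_sq_deriv hxb
    (fun t ht => (hderiv t (hright ht)).mono hright) (hcont.mono hright)
  rw [← intervalIntegral.integral_add_adjacent_intervals (f := fun t => f' t ^ 2)
    (((hcont.mono hleft).pow 2).intervalIntegrable_of_Icc hax)
    (((hcont.mono hright).pow 2).intervalIntegrable_of_Icc hxb)]
  have hA : 0 ≤ ∫ t in a..x, f' t ^ 2 :=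
    intervalIntegral.integral_nonneg hax fun t _ => sq_nonneg _
  have hB : 0 ≤ ∫ t in x..b, f' t ^ 2 :=
    intervalIntegral.integral_nonneg hxb fun t _ => sq_nonneg _
  set A := ∫ t in a..x, f' t ^ 2
  set B := ∫ t in x..b, f' t ^ 2
  rw [show x - a = s * (b - a) by rw [hx]; ring] at h₁
  rw [show b - x = (1 - s) * (b - a) by rw [hx]; ring] at h₂
  have hs' : 0 ≤ 1 - s := sub_nonneg.2 hs₁
  calc (f a + s * (f b - f a) - f x) ^ 2
      = (1 - s) * (f x - f a) ^ 2 + s * (f b - f x) ^ 2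
        - s * (1 - s) * (f b - f a) ^ 2 := by ring
    _ ≤ (1 - s) * (f x - f a) ^ 2 + s * (f b - f x) ^ 2 := by
        have := mul_nonneg (mul_nonneg hs₀ hs') (sq_nonneg (f b - f a))
        linarith
    _ ≤ (1 - s) * (s * (b - a) * A) + s * ((1 - s) * (b - a) * B) := by gcongr
    _ = s * (1 - s) * ((b - a) * (A + B)) := by ring
    _ ≤ 1 * ((b - a) * (A + B)) := by
        gcongr
        nlinarith
    _ = (b - a) * (A + B) := one_mul _

/-- Every point of `[0, 1]` lies in one of the `m` intervals `[j / m, (j + 1) / m]`. -/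
theorem exists_mem_Icc_div {m : ℕ} (hm : 0 < m) {θ : ℝ} (hθ : θ ∈ Icc (0 : ℝ) 1) :
    ∃ j : ℕ, j < m ∧ θ ∈ Icc ((j : ℝ) / m) (((j : ℝ) + 1) / m) := by
  have hm' : (0 : ℝ) < m := Nat.cast_pos.2 hm
  rcases hθ.2.eq_or_lt with rfl | hlt
  · refine ⟨m - 1, by omega, ?_, ?_⟩
    · rw [div_le_one hm']
      exact_mod_cast Nat.sub_le m 1
    · rw [one_le_div hm']
      exact_mod_cast (by omega : m ≤ m - 1 + 1)
  · have h₀ : 0 ≤ θ * m := mul_nonneg hθ.1 hm'.le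
    refine ⟨⌊θ * m⌋₊, (Nat.floor_lt h₀).2 (by nlinarith), ?_, ?_⟩
    · rw [div_le_iff₀ hm']
      exact Nat.floor_le h₀
    · rw [le_div_iff₀ hm']
      exact (Nat.lt_floor_add_one _).le

/-- The uniform error of piecewise-linear interpolation on `[0, 1]` with mesh `1 / m` is controlled
by the `L²` norm of the derivative. -/
theorem sq_piecewise_linear_error_le {f f' g : ℝ → ℝ} {m : ℕ} (hm : 0 < m)
    (hderiv : ∀ θ ∈ Icc (0 : ℝ) 1, HasDerivWithinAt f (f' θ) (Icc (0 : ℝ) 1) θ)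
    (hcont : ContinuousOn f' (Icc (0 : ℝ) 1))
    (hg : ∀ j : ℕ, j < m → ∀ θ ∈ Icc ((j : ℝ) / m) (((j : ℝ) + 1) / m),
      g θ = f ((j : ℝ) / m) + (m : ℝ) * (θ - (j : ℝ) / m)
        * (f (((j : ℝ) + 1) / m) - f ((j : ℝ) / m)))
    {θ : ℝ} (hθ : θ ∈ Icc (0 : ℝ) 1) :
    (g θ - f θ) ^ 2 ≤ 1 / (m : ℝ) * ∫ t in (0 : ℝ)..1, f' t ^ 2 := by
  obtain ⟨j, hj, hθj⟩ := exists_mem_Icc_div hm hθ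
  have hm' : (0 : ℝ) < m := Nat.cast_pos.2 hm
  rw [hg j hj θ hθj]
  set a := (j : ℝ) / m with ha
  set b := ((j : ℝ) + 1) / m with hb
  have hlen : b - a = 1 / m := by rw [ha, hb]; ring
  have hmul : (m : ℝ) * (b - a) = 1 := by rw [hlen]; field_simp
  have hab : a ≤ b := hθj.1.trans hθj.2
  have ha₀ : 0 ≤ a := by positivity
  have hb₁ : b ≤ 1 := by
    rw [hb, div_le_one hm']
    exact_mod_cast hj
  have hsub : Icc a b ⊆ Icc (0 : ℝ) 1 := Icc_subset_Icc ha₀ hb₁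
  have hs : (m : ℝ) * (θ - a) ∈ Icc (0 : ℝ) 1 :=
    ⟨mul_nonneg hm'.le (sub_nonneg.2 hθj.1), by
      rw [← hmul]; exact mul_le_mul_of_nonneg_left (sub_le_sub_right hθj.2 a) hm'.le⟩
  have hpoint : a + (m : ℝ) * (θ - a) * (b - a) = θ := by
    linear_combination (θ - a) * hmul
  have key := sq_affine_interpolation_error_le hab
    (fun t ht => (hderiv t (hsub ht)).mono hsub) (hcont.mono hsub) hs
  rw [hpoint, hlen] at key
  refine key.trans (mul_le_mul_of_nonneg_left ?_ (by positivity))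
  exact intervalIntegral.integral_mono_interval ha₀ hab hb₁
    (Filter.Eventually.of_forall fun t => sq_nonneg _)
    ((hcont.pow 2).intervalIntegrable_of_Icc zero_le_one)

/-- Lemma 7.4: if `Y` is a stochastic process on `[0,1]` with continuously differentiable
sample paths and `Yδ` is its piecewise-linear interpolant at the knots `j/m`, then
`P(sup_{θ∈[0,1]} |Yδ − Y| ≥ ε) ≤ (δ/ε²) · E ∫_0^1 (Y')² dθ`, where `δ = 1/m`. -/
theorem stmt_3 {Ω : Type*} [MeasurableSpace Ω] (P : Measure Ω) [IsProbabilityMeasure P]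
    (Y Y' : Ω → ℝ → ℝ)
    (hYmeas : Measurable (Function.uncurry Y))
    (hY'meas : Measurable (Function.uncurry Y'))
    (hderiv : ∀ ω, ∀ θ ∈ Icc (0:ℝ) 1,
      HasDerivWithinAt (Y ω) (Y' ω θ) (Icc (0:ℝ) 1) θ)
    (hcont : ∀ ω, ContinuousOn (Y' ω) (Icc (0:ℝ) 1))
    (hint : Integrable (fun ω => ∫ θ in (0:ℝ)..1, (Y' ω θ) ^ 2) P)
    (m : ℕ) (hm : 0 < m)
    (Yδ : Ω → ℝ → ℝ)
    (hYδ : ∀ ω, ∀ j : ℕ, j < m → ∀ θ ∈ Icc ((j : ℝ) / m) (((j : ℝ) + 1) / m),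
      Yδ ω θ = Y ω ((j : ℝ) / m) + (m : ℝ) * (θ - (j : ℝ) / m)
        * (Y ω (((j : ℝ) + 1) / m) - Y ω ((j : ℝ) / m)))
    (ε : ℝ) (hε : 0 < ε) :
    P {ω | ε ≤ sSup ((fun θ => |Yδ ω θ - Y ω θ|) '' Icc (0:ℝ) 1)}
      ≤ ENNReal.ofReal ((1 / (m : ℝ)) / ε ^ 2
          * ∫ ω, (∫ θ in (0:ℝ)..1, (Y' ω θ) ^ 2) ∂P) := by
  have hm' : (0 : ℝ) < m := Nat.cast_pos.2 hm
  set I : Ω → ℝ := fun ω => ∫ θ in (0:ℝ)..1, (Y' ω θ) ^ 2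
  have hI₀ : ∀ ω, 0 ≤ I ω := fun ω =>
    intervalIntegral.integral_nonneg zero_le_one fun t _ => sq_nonneg _
  have hsubset : {ω | ε ≤ sSup ((fun θ => |Yδ ω θ - Y ω θ|) '' Icc (0:ℝ) 1)}
      ⊆ {ω | m * ε ^ 2 ≤ I ω} := by
    intro ω hω
    have hsup : sSup ((fun θ => |Yδ ω θ - Y ω θ|) '' Icc (0:ℝ) 1) ≤ √(1 / (m : ℝ) * I ω) := by
      refine csSup_le ((nonempty_Icc.2 zero_le_one).image _) ?_
      rintro _ ⟨θ, hθ, rfl⟩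
      exact Real.abs_le_sqrt
        (sq_piecewise_linear_error_le hm (hderiv ω) (hcont ω) (hYδ ω) hθ)
    have hsq : ε ^ 2 ≤ 1 / (m : ℝ) * I ω := (Real.le_sqrt' hε).1 (le_trans hω hsup)
    rw [one_div_mul_eq_div, le_div_iff₀' hm'] at hsq
    exact hsq
  have hmarkov := mul_meas_ge_le_integral_of_nonneg (Filter.Eventually.of_forall hI₀) hint
    (m * ε ^ 2)
  refine (measure_mono hsubset).trans ?_
  rw [← ofReal_measureReal]
  refine ENNReal.ofReal_le_ofReal ?_
  rw [div_div, one_div_mul_eq_div, le_div_iff₀' (by positivity)]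
  exact hmarkov
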